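/- Let X be a set, let P be the set of functions from X to the closed real interval [0,1], and let F be the Riesz space of all functions P → ℝ with pointwise operations and pointwise order. For x ∈ X let π_x ∈ F be the coordinate projection π_x(p) = p(x). Let G be the smallest sublattice-subgroup of F containing the constant function 1 and all projections π_x, and let U be the smallest vector sublattice of F containing the constant function 1 and all projections π_x. Then U is the smallest vector sublattice of F containing G, and the inclusion of G into U is essential: for every f ∈ U with f > 0 there exist g ∈ G with g > 0 and n ∈ ℕ with g ≤ n • f. (Function-algebra form of: the Riesz hull of the free MV-algebra over X is the free Riesz MV-algebra over X, so the free MV-algebra is essentially embedded in the free Riesz MV-algebra.) -/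

import Mathlib

/-- The smallest sublattice-subgroup of `V` containing a set `S`: the intersection of
all additive subgroups of `V` closed under binary suprema and infima that contain `S`. -/
def latticeSubgroupClosure (V : Type) [Lattice V] [AddCommGroup V] (S : Set V) : Set V :=
  ⋂₀ {T : Set V | ∃ A : AddSubgroup V, (A : Set V) = T ∧
      (∀ a ∈ A, ∀ b ∈ A, a ⊔ b ∈ A) ∧ (∀ a ∈ A, ∀ b ∈ A, a ⊓ b ∈ A) ∧ S ⊆ T}

/-- The smallest vector sublattice of `V` containing a set `S`: the intersection of all
linear subspaces of `V` closed under binary suprema and infima that contain `S`. -/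
def vectorSublatticeClosure (V : Type) [Lattice V] [AddCommGroup V] [Module ℝ V]
    (S : Set V) : Set V :=
  ⋂₀ {T : Set V | ∃ M : Submodule ℝ V, (M : Set V) = T ∧
      (∀ a ∈ M, ∀ b ∈ M, a ⊔ b ∈ M) ∧ (∀ a ∈ M, ∀ b ∈ M, a ⊓ b ∈ M) ∧ S ⊆ T}

/-- The smallest sublattice-subgroup containing `S` is itself a sublattice-subgroup
containing `S`. -/
theorem exists_addSubgroup_eq_latticeSubgroupClosure {V : Type} [Lattice V] [AddCommGroup V]
    (S : Set V) :
    ∃ A : AddSubgroup V, (A : Set V) = latticeSubgroupClosure V S ∧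
      (∀ a ∈ A, ∀ b ∈ A, a ⊔ b ∈ A) ∧ (∀ a ∈ A, ∀ b ∈ A, a ⊓ b ∈ A) ∧ S ⊆ A := by
  refine ⟨sInf {A | (∀ a ∈ A, ∀ b ∈ A, a ⊔ b ∈ A) ∧ (∀ a ∈ A, ∀ b ∈ A, a ⊓ b ∈ A) ∧
    S ⊆ (A : Set V)}, ?_, ?_, ?_, ?_⟩
  · ext v
    rw [SetLike.mem_coe, AddSubgroup.mem_sInf]
    constructor
    · rintro hv _ ⟨A, rfl, hA⟩
      exact hv A hA
    · exact fun hv A hA => hv _ ⟨A, rfl, hA⟩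
  · intro a ha b hb
    rw [AddSubgroup.mem_sInf] at *
    exact fun A hA => hA.1 a (ha A hA) b (hb A hA)
  · intro a ha b hb
    rw [AddSubgroup.mem_sInf] at *
    exact fun A hA => hA.2.1 a (ha A hA) b (hb A hA)
  · intro s hs
    rw [SetLike.mem_coe, AddSubgroup.mem_sInf]
    exact fun A hA => hA.2.2 hs

/-- A set and the sublattice-subgroup it generates generate the same vector sublattice. -/
theorem vectorSublatticeClosure_latticeSubgroupClosure {V : Type} [Lattice V] [AddCommGroup V]
    [Module ℝ V] {S : Set V} :
    vectorSublatticeClosure V (latticeSubgroupClosure V S) = vectorSublatticeClosure V S := by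
  ext v
  constructor
  · rintro hv _ ⟨M, rfl, hsup, hinf, hS⟩
    refine hv _ ⟨M, rfl, hsup, hinf, fun u hu => ?_⟩
    exact hu _ ⟨M.toAddSubgroup, rfl, hsup, hinf, hS⟩
  · rintro hv _ ⟨M, rfl, hsup, hinf, hS⟩
    refine hv _ ⟨M, rfl, hsup, hinf, fun s hs => hS ?_⟩
    rintro _ ⟨A, rfl, -, -, hA⟩
    exact hA hs

/-- The vector sublattice generated by continuous functions consists of continuous functions. -/
theorem continuous_of_mem_vectorSublatticeClosure {P : Type} [TopologicalSpace P]
    {S : Set (P → ℝ)} (hS : ∀ s ∈ S, Continuous s) {f : P → ℝ}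
    (hf : f ∈ vectorSublatticeClosure (P → ℝ) S) : Continuous f := by
  let M : Submodule ℝ (P → ℝ) :=
    { carrier := {h | Continuous h}
      add_mem' := fun ha hb => Continuous.add ha hb
      zero_mem' := continuous_const
      smul_mem' := fun c _ hx => Continuous.const_smul hx c }
  exact hf _ ⟨M, rfl, fun _ ha _ hb => Continuous.sup ha hb,
    fun _ ha _ hb => Continuous.inf ha hb, hS⟩

/-- In a sublattice-subgroup of the functions on `[0,1]^X` which contains `1` and the
projections, every neighbourhood of every point `p` supports a function with values in `[0,1]`
that is positive at `p`. -/
theorem exists_bump_mem {X : Type} {A : AddSubgroup ((X → Set.Icc (0 : ℝ) 1) → ℝ)}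
    (hsup : ∀ a ∈ A, ∀ b ∈ A, a ⊔ b ∈ A) (hinf : ∀ a ∈ A, ∀ b ∈ A, a ⊓ b ∈ A)
    (hone : (fun _ => 1) ∈ A) (hproj : ∀ x : X, (fun p => (p x : ℝ)) ∈ A)
    (p : X → Set.Icc (0 : ℝ) 1) {W : Set (X → Set.Icc (0 : ℝ) 1)} (hW : W ∈ nhds p) :
    ∃ g ∈ A, (∀ q, 0 ≤ g q) ∧ (∀ q, g q ≤ 1) ∧ 0 < g p ∧ ∀ q ∉ W, g q = 0 := by
  let L : Filter (X → Set.Icc (0 : ℝ) 1) :=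
    { sets := {W | ∃ g ∈ A, (∀ q, 0 ≤ g q) ∧ (∀ q, g q ≤ 1) ∧ 0 < g p ∧ ∀ q ∉ W, g q = 0}
      univ_sets := ⟨fun _ => 1, hone, fun _ => zero_le_one, fun _ => le_rfl, one_pos,
        fun q hq => absurd (Set.mem_univ q) hq⟩
      sets_of_superset := by
        rintro W W' ⟨g, hgA, hg0, hg1, hgp, hgW⟩ hWW'
        exact ⟨g, hgA, hg0, hg1, hgp, fun q hq => hgW q fun h => hq (hWW' h)⟩
      inter_sets := by
        rintro W W' ⟨g, hgA, hg0, hg1, hgp, hgW⟩ ⟨g', hgA', hg0', hg1', hgp', hgW'⟩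
        refine ⟨g ⊓ g', hinf _ hgA _ hgA', fun q => le_inf (hg0 q) (hg0' q),
          fun q => inf_le_left.trans (hg1 q), lt_inf_iff.2 ⟨hgp, hgp'⟩, fun q hq => ?_⟩
        rw [Pi.inf_apply]
        by_cases h : q ∈ W
        · rw [hgW' q fun h' => hq ⟨h, h'⟩]
          exact inf_eq_right.2 (hg0 q)
        · rw [hgW q h]
          exact inf_eq_left.2 (hg0' q) }
  suffices hL : L ≤ nhds p from hL hW
  change Filter.Tendsto id L (nhds p)
  refine tendsto_pi_nhds.2 fun x => Metric.tendsto_nhds.2 fun ε hε => ?_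
  obtain ⟨m, hm⟩ := exists_nat_gt (2 / ε)
  have hm0 : (0 : ℝ) < m := (by positivity : (0 : ℝ) < 2 / ε).trans hm
  rw [div_lt_iff₀ hε] at hm
  let j : ℤ := round (m * (p x : ℝ))
  let d : (X → Set.Icc (0 : ℝ) 1) → ℝ := m • (fun q => (q x : ℝ)) - j • (fun _ => 1)
  have hdA : d ∈ A := A.sub_mem (A.nsmul_mem (hproj x) m) (A.zsmul_mem hone j)
  have hd : ∀ q, d q = m * (q x : ℝ) - j := fun q => by simp [d]
  have hdp : |d p| ≤ 1 / 2 := by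
    rw [hd]
    exact abs_sub_round _
  have hg : ∀ q, (((fun _ => 1) - (d ⊔ -d)) ⊔ 0 : (X → Set.Icc (0 : ℝ) 1) → ℝ) q =
      max (1 - |d q|) 0 := fun q => rfl
  refine ⟨((fun _ => 1) - (d ⊔ -d)) ⊔ 0,
    hsup _ (A.sub_mem hone (hsup _ hdA _ (A.neg_mem hdA))) _ A.zero_mem, ?_, ?_, ?_, ?_⟩
  · exact fun q => le_max_right _ _
  · intro q
    rw [hg]
    exact max_le (by linarith [abs_nonneg (d q)]) zero_le_one
  · rw [hg]
    exact lt_max_of_lt_left (by linarith)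
  · intro q hq
    rw [hg]
    refine max_eq_right (sub_nonpos.2 (le_of_not_gt fun hlt => hq ?_))
    change dist (q x) (p x) < ε
    rw [Subtype.dist_eq, Real.dist_eq]
    rw [hd] at hdp hlt
    have key : m * |(q x : ℝ) - p x| < 2 := by
      rw [← abs_of_pos hm0, ← abs_mul]
      rw [abs_lt] at hlt ⊢
      rw [abs_le] at hdp
      constructor <;> linarith
    exact lt_of_mul_lt_mul_left (by linarith) hm0.le

/-- Function-algebra form of: the Riesz hull of the free MV-algebra over `X` is the
free Riesz MV-algebra over `X`. In the Riesz space `F` of all real functions on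
`P = [0,1]^X`, let `G` be the sublattice-subgroup generated by the constant `1` and the
projections, and `U` the vector sublattice they generate. Then `U` is the smallest
vector sublattice containing `G`, and the inclusion `G ⊆ U` is essential. -/
theorem free_mv_algebra_essential_in_free_riesz
    (X : Type) :
    let P : Type := X → (Set.Icc (0 : ℝ) 1)
    let F : Type := P → ℝ
    let gens : Set F := insert (fun _ => 1) {f : F | ∃ x : X, f = fun p => (p x : ℝ)}
    let G : Set F := latticeSubgroupClosure F gens
    let U : Set F := vectorSublatticeClosure F gens
    U = vectorSublatticeClosure F G ∧
    ∀ f ∈ U, 0 < f → ∃ g ∈ G, 0 < g ∧ ∃ n : ℕ, g ≤ n • f := by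
  intro P F gens G U
  refine ⟨vectorSublatticeClosure_latticeSubgroupClosure.symm, fun f hfU hf => ?_⟩
  obtain ⟨hf0, p, hp⟩ := Pi.lt_def.1 hf
  have hfc : Continuous f := by
    refine continuous_of_mem_vectorSublatticeClosure (S := gens) ?_ hfU
    rintro _ (rfl | ⟨x, rfl⟩)
    · exact continuous_const
    · exact continuous_subtype_val.comp (continuous_apply x)
  obtain ⟨A, hA, hsup, hinf, hgens⟩ := exists_addSubgroup_eq_latticeSubgroupClosure gens
  have hp' : 0 < f p := hp
  obtain ⟨g, hgA, hg0, hg1, hgp, hgW⟩ := exists_bump_mem hsup hinf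
    (hgens (Set.mem_insert _ _)) (fun x => hgens (Set.mem_insert_of_mem _ ⟨x, rfl⟩)) p
    (hfc.continuousAt.eventually_const_lt (half_lt_self hp'))
  obtain ⟨n, hn⟩ := exists_nat_gt (2 / f p)
  refine ⟨g, hA.subset hgA, Pi.lt_def.2 ⟨hg0, p, hgp⟩, n, fun q => ?_⟩
  rw [Pi.smul_apply, nsmul_eq_mul]
  by_cases hq : f p / 2 < f q
  · rw [div_lt_iff₀ hp'] at hn
    have h1 := hg1 q
    have hn0 : (0 : ℝ) ≤ n := n.cast_nonneg
    nlinarith [mul_le_mul_of_nonneg_left hq.le hn0]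
  · rw [hgW q hq]
    exact mul_nonneg n.cast_nonneg (hf0 q)
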